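/- Let α ∈ (0,1). Let F : ℝ² → ℝ be bounded with finite parabolic Hölder seminorm [F]_α, and let G : ℝ² → ℝ have finite parabolic Hölder seminorm [G]_α and be twice differentiable in x₁ away from {x₂ = 0} with |∂₁^k G(x)| ≤ C(G)·|x₂|^{(α−k)/2} for k = 1, 2 and all x with x₂ ≠ 0. For T ∈ (0,1] define the renormalized commutator Comm_T(x) := G(x)·(F * ∂₁²ψ_T)(x) − ((F·G) * ∂₁²ψ_T)(x) + 2·((F·∂₁G) * ∂₁ψ_T)(x) − ((F·∂₁²G) * ψ_T)(x), corresponding to the generalized product G ◊ ∂₁²F := ∂₁²(FG) − 2∂₁(F·∂₁G) + F·∂₁²G. Then there is a constant C(α) such that for all T ∈ (0,1] and x ∈ ℝ²: |Comm_T(x)| ≤ C(α) · (C(G) + [G]_α) · [F]_α · T^{(2α−2)/4}. -/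

import Mathlib

open MeasureTheory

/-- The parabolic distance on `ℝ²`. -/
noncomputable def pdist (x y : ℝ × ℝ) : ℝ := |x.1 - y.1| + Real.sqrt |x.2 - y.2|

/-- Partial derivative in the first (space-like) variable. -/
noncomputable def pd1 (f : ℝ × ℝ → ℝ) : ℝ × ℝ → ℝ := fun x => deriv (fun s => f (s, x.2)) x.1

/-- Partial derivative in the second (time-like) variable. -/
noncomputable def pd2 (f : ℝ × ℝ → ℝ) : ℝ × ℝ → ℝ := fun x => deriv (fun s => f (x.1, s)) x.2

def IsPsiKernel (ψ : ℝ → ℝ × ℝ → ℝ) : Prop :=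
  (∀ T : ℝ, 0 < T → ∃ φ : SchwartzMap (ℝ × ℝ) ℝ, ψ T = ⇑φ) ∧
  (∃ C : ℝ, ∀ T : ℝ, 0 < T → ∀ k : ℝ × ℝ,
      (∫ x : ℝ × ℝ,
          Complex.exp (-(2 * Real.pi * (k.1 * x.1 + k.2 * x.2) : ℝ) * Complex.I) * (ψ T x : ℂ))
        = (C : ℂ) * Complex.exp ((-(T * (k.1 ^ 4 + k.2 ^ 2)) : ℝ) : ℂ)) ∧
  (∫ x : ℝ × ℝ, |ψ 1 x|) = 1

/-- The renormalized commutator `[G, (·)_T] ◊ ∂₁²F` associated with the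
generalized product `G ◊ ∂₁²F := ∂₁²(FG) - 2∂₁(F·∂₁G) + F·∂₁²G`. -/
noncomputable def commT (ψ : ℝ → ℝ × ℝ → ℝ) (T : ℝ) (F G : ℝ × ℝ → ℝ) (x : ℝ × ℝ) : ℝ :=
  G x * (∫ y : ℝ × ℝ, F y * pd1 (pd1 (ψ T)) (x - y))
    - (∫ y : ℝ × ℝ, (F y * G y) * pd1 (pd1 (ψ T)) (x - y))
    + 2 * (∫ y : ℝ × ℝ, (F y * pd1 G y) * pd1 (ψ T) (x - y))
    - (∫ y : ℝ × ℝ, (F y * pd1 (pd1 G) y) * ψ T (x - y))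


/-! ### Anisotropic scaling -/

section Kernel

open FourierTransform

lemma map_volume_div_div {a b : ℝ} (ha : a ≠ 0) (hb : b ≠ 0) :
    Measure.map (fun x : ℝ × ℝ => (x.1 / a, x.2 / b)) volume
      = ENNReal.ofReal |a * b| • (volume : Measure (ℝ × ℝ)) := by
  have h1 : Measure.map (fun x : ℝ => x / a) volume = ENNReal.ofReal |a| • volume := by
    simpa [div_eq_mul_inv] using Real.map_volume_mul_right (inv_ne_zero ha)
  have h2 : Measure.map (fun x : ℝ => x / b) volume = ENNReal.ofReal |b| • volume := by
    simpa [div_eq_mul_inv] using Real.map_volume_mul_right (inv_ne_zero hb)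
  have h := Measure.map_prod_map (volume : Measure ℝ) (volume : Measure ℝ)
    (f := fun x : ℝ => x / a) (g := fun x : ℝ => x / b) (by fun_prop) (by fun_prop)
  rw [h1, h2, Measure.prod_smul_left, Measure.prod_smul_right, smul_smul,
    ← ENNReal.ofReal_mul (abs_nonneg a), ← abs_mul] at h
  exact h.symm

lemma Continuous.eq_zero_of_fourier_eq_zero {h : ℝ × ℝ → ℂ} (hc : Continuous h)
    (hi : Integrable h)
    (h0 : ∀ k : ℝ × ℝ, (∫ x : ℝ × ℝ,
      Complex.exp (-(2 * Real.pi * (k.1 * x.1 + k.2 * x.2) : ℝ) * Complex.I) * h x) = 0) :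
    h = 0 := by
  have hmp := WithLp.volume_preserving_ofLp ℝ ℝ
  have hme : MeasurableEmbedding (WithLp.ofLp : WithLp 2 (ℝ × ℝ) → ℝ × ℝ) :=
    (WithLp.homeomorphProd 2 ℝ ℝ).measurableEmbedding
  set g : WithLp 2 (ℝ × ℝ) → ℂ := fun v => h v.ofLp
  have hgc : Continuous g := hc.comp (WithLp.homeomorphProd 2 ℝ ℝ).continuous
  have hgi : Integrable g := (hmp.integrable_comp_emb hme).2 hi
  have hg0 : 𝓕 g = 0 := by
    ext w
    rw [Real.fourier_eq', Pi.zero_apply, ← h0 w.ofLp, ← hmp.integral_comp hme]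
    congr with v
    simp only [WithLp.prod_inner_apply, smul_eq_mul, g]
    congr 3
    simp
  have hinv := hgc.fourierInv_fourier_eq hgi (by rw [hg0]; exact integrable_zero _ _ _)
  ext x
  have := congrFun hinv (WithLp.toLp 2 x)
  rw [hg0] at this
  simpa [Real.fourierInv_eq, g] using this.symm

lemma IsPsiKernel.scaling {ψ : ℝ → ℝ × ℝ → ℝ} (hψ : IsPsiKernel ψ) {l : ℝ} (hl : 0 < l)
    (z : ℝ × ℝ) : ψ (l ^ 4) z = (l ^ 3)⁻¹ * ψ 1 (z.1 / l, z.2 / l ^ 2) := by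
  obtain ⟨hS, ⟨C, hC⟩, -⟩ := hψ
  obtain ⟨φ, hφ⟩ := hS (l ^ 4) (by positivity)
  obtain ⟨φ₁, hφ₁⟩ := hS 1 one_pos
  have hl0 := hl.ne'
  have hmap := map_volume_div_div hl0 (pow_ne_zero 2 hl0)
  have hdm : Measurable (fun x : ℝ × ℝ => (x.1 / l, x.2 / l ^ 2)) := by fun_prop
  have hi1 : Integrable (fun x : ℝ × ℝ => φ₁ (x.1 / l, x.2 / l ^ 2)) := by
    have : Integrable (fun x : ℝ × ℝ => φ₁ x)
        (Measure.map (fun x : ℝ × ℝ => (x.1 / l, x.2 / l ^ 2)) volume) := by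
      rw [hmap]
      exact φ₁.integrable.smul_measure ENNReal.ofReal_ne_top
    exact this.comp_measurable hdm
  have hi2 : Integrable (fun x : ℝ × ℝ => (l ^ 3)⁻¹ * φ₁ (x.1 / l, x.2 / l ^ 2)) :=
    hi1.const_mul _
  have hbdd {f : ℝ × ℝ → ℂ} (hf : Integrable f) (k : ℝ × ℝ) : Integrable (fun x : ℝ × ℝ =>
      Complex.exp (-(2 * Real.pi * (k.1 * x.1 + k.2 * x.2) : ℝ) * Complex.I) * f x) := by
    refine hf.bdd_mul (c := 1) (Continuous.aestronglyMeasurable (by fun_prop))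
      (.of_forall fun x => ?_)
    rw [← Complex.ofReal_neg, Complex.norm_exp_ofReal_mul_I]
  have hscaled (k : ℝ × ℝ) : ∫ x : ℝ × ℝ,
      Complex.exp (-(2 * Real.pi * (k.1 * x.1 + k.2 * x.2) : ℝ) * Complex.I) *
        (((l ^ 3)⁻¹ * φ₁ (x.1 / l, x.2 / l ^ 2) : ℝ) : ℂ)
      = C * Complex.exp ((-(l ^ 4 * (k.1 ^ 4 + k.2 ^ 2)) : ℝ) : ℂ) := by
    have h1 := hC 1 one_pos (l * k.1, l ^ 2 * k.2)
    rw [hφ₁] at h1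
    set e : ℝ × ℝ → ℂ := fun x => Complex.exp
      (-(2 * Real.pi * (l * k.1 * x.1 + l ^ 2 * k.2 * x.2) : ℝ) * Complex.I) * (φ₁ x : ℂ)
    have he : Continuous e := by
      have := φ₁.continuous
      fun_prop
    have h2 : ∫ x : ℝ × ℝ, e (x.1 / l, x.2 / l ^ 2) = (l ^ 3 : ℝ) * ∫ x, e x := by
      rw [← integral_map (f := e) hdm.aemeasurable he.aestronglyMeasurable, hmap,
        integral_smul_measure, ENNReal.toReal_ofReal (abs_nonneg _),
        abs_of_pos (by positivity), Complex.real_smul]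
      congr 2
      ring
    have h3 : ∀ x : ℝ × ℝ,
        Complex.exp (-(2 * Real.pi * (k.1 * x.1 + k.2 * x.2) : ℝ) * Complex.I) *
        (((l ^ 3)⁻¹ * φ₁ (x.1 / l, x.2 / l ^ 2) : ℝ) : ℂ)
        = ((l ^ 3 : ℝ) : ℂ)⁻¹ * e (x.1 / l, x.2 / l ^ 2) := by
      intro x
      simp only [e]
      rw [show l * k.1 * (x.1 / l) + l ^ 2 * k.2 * (x.2 / l ^ 2) = k.1 * x.1 + k.2 * x.2 by
        field_simp]
      push_cast
      ring
    simp_rw [h3]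
    rw [integral_const_mul, h2, ← mul_assoc, inv_mul_cancel₀ (by
      exact_mod_cast pow_ne_zero 3 hl0), one_mul, h1]
    congr 4
    ring
  have hφc : Integrable (fun x => (φ x : ℂ)) := φ.integrable.ofReal
  have hφ₁c : Integrable (fun x : ℝ × ℝ =>
    (((l ^ 3)⁻¹ * φ₁ (x.1 / l, x.2 / l ^ 2) : ℝ) : ℂ)) := hi2.ofReal
  have key := Continuous.eq_zero_of_fourier_eq_zero
    (h := fun x => (φ x : ℂ) - (((l ^ 3)⁻¹ * φ₁ (x.1 / l, x.2 / l ^ 2) : ℝ) : ℂ))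
    (by
      have := φ.continuous
      have := φ₁.continuous
      fun_prop)
    (hφc.sub hφ₁c)
    (fun k => by
      simp_rw [mul_sub]
      rw [integral_sub (hbdd hφc k) (hbdd hφ₁c k), hscaled k, sub_eq_zero]
      have := hC (l ^ 4) (by positivity) k
      rwa [hφ] at this)
  have h := congrFun key z
  simp only [Pi.zero_apply, sub_eq_zero] at h
  rw [hφ, hφ₁]
  exact_mod_cast h

end Kernel

lemma ae_snd_ne_zero : ∀ᵐ y : ℝ × ℝ, y.2 ≠ 0 :=
  Measure.quasiMeasurePreserving_snd.ae (p := fun s : ℝ => s ≠ 0)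
    (compl_mem_ae_iff.2 (measure_singleton 0))

lemma pd1_scale (f : ℝ × ℝ → ℝ) (c a b : ℝ) :
    pd1 (fun z => c * f (z.1 / a, z.2 / b)) = fun z => c / a * pd1 f (z.1 / a, z.2 / b) := by
  ext z
  simp only [pd1, deriv_const_mul_field']
  have := deriv_comp_mul_left a⁻¹ (fun s => f (s, z.2 / b)) z.1
  simp only [inv_mul_eq_div, smul_eq_mul] at this
  rw [this]
  ring

lemma SchwartzMap.hasDerivAt_fst (φ : SchwartzMap (ℝ × ℝ) ℝ) (z : ℝ × ℝ) :
    HasDerivAt (fun s => φ (s, z.2)) (fderiv ℝ φ z (1, 0)) z.1 := by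
  have h := (φ.differentiableAt (x := z)).hasFDerivAt
  exact h.comp_hasDerivAt z.1 ((hasDerivAt_id z.1).prodMk (hasDerivAt_const z.1 z.2))

lemma SchwartzMap.exists_eq_pd1 (φ : SchwartzMap (ℝ × ℝ) ℝ) :
    ∃ φ' : SchwartzMap (ℝ × ℝ) ℝ, pd1 φ = φ' :=
  ⟨LineDeriv.lineDerivOp ((1 : ℝ), (0 : ℝ)) φ, funext fun z => by
    rw [SchwartzMap.lineDerivOp_apply_eq_fderiv]
    exact (φ.hasDerivAt_fst z).deriv⟩

lemma SchwartzMap.hasDerivAt_pd1 (φ : SchwartzMap (ℝ × ℝ) ℝ) (z : ℝ × ℝ) :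
    HasDerivAt (fun s => φ (s, z.2)) (pd1 φ z) z.1 :=
  (φ.hasDerivAt_fst z).differentiableAt.hasDerivAt

/-- The integrable profile `(1 + s²)⁻¹`. -/
noncomputable def cauchyWeight (s : ℝ) : ℝ := (1 + s ^ 2)⁻¹

lemma cauchyWeight_pos (s : ℝ) : 0 < cauchyWeight s := by unfold cauchyWeight; positivity

lemma cauchyWeight_le_one (s : ℝ) : cauchyWeight s ≤ 1 :=
  inv_le_one_of_one_le₀ (by nlinarith [sq_nonneg s])

lemma continuous_cauchyWeight : Continuous cauchyWeight := by
  unfold cauchyWeight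
  exact Continuous.inv₀ (by fun_prop) fun s => by positivity

lemma integrable_cauchyWeight : Integrable cauchyWeight := integrable_inv_one_add_sq

lemma SchwartzMap.exists_cauchyWeight_bound (φ : SchwartzMap (ℝ × ℝ) ℝ) :
    ∃ M : ℝ, 0 ≤ M ∧ ∀ z : ℝ × ℝ,
      |φ z| ≤ M * (cauchyWeight z.1 * cauchyWeight z.2) ^ 2 := by
  obtain ⟨M, hM⟩ : ∃ M : ℝ, ∀ z, (1 + ‖z‖) ^ 8 * |φ z| ≤ M :=
    ⟨_, fun z => by
      simpa using SchwartzMap.one_add_le_sup_seminorm_apply (𝕜 := ℝ) (m := (8, 0)) (k := 8) (n := 0)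
        le_rfl le_rfl φ z⟩
  refine ⟨M, le_trans (by positivity) (hM 0), fun z => ?_⟩
  have h1 : (1 + z.1 ^ 2) ≤ (1 + ‖z‖) ^ 2 := by
    have : |z.1| ≤ ‖z‖ := norm_fst_le z
    nlinarith [sq_abs z.1, abs_nonneg z.1]
  have h2 : (1 + z.2 ^ 2) ≤ (1 + ‖z‖) ^ 2 := by
    have : |z.2| ≤ ‖z‖ := norm_snd_le z
    nlinarith [sq_abs z.2, abs_nonneg z.2]
  have h3 : ((1 + z.1 ^ 2) * (1 + z.2 ^ 2)) ^ 2 ≤ (1 + ‖z‖) ^ 8 := by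
    calc _ ≤ ((1 + ‖z‖) ^ 2 * (1 + ‖z‖) ^ 2) ^ 2 := by gcongr
      _ = _ := by ring
  rw [cauchyWeight, cauchyWeight, ← mul_inv, inv_pow, ← div_eq_mul_inv,
    le_div_iff₀ (by positivity), mul_comm]
  exact (mul_le_mul_of_nonneg_right h3 (abs_nonneg _)).trans (hM z)

lemma exists_integral_abs_rpow_mul_cauchyWeight_le {β : ℝ} (hβ : 0 ≤ β) (hβ1 : β < 1) :
    ∃ K : ℝ, 0 ≤ K ∧ ∀ a h : ℝ, 0 < h →
      Integrable (fun s => |s| ^ (-β) * cauchyWeight ((a - s) / h)) ∧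
      ∫ s, |s| ^ (-β) * cauchyWeight ((a - s) / h) ≤ K * h ^ (1 - β) := by
  set g : ℝ → ℝ := (Set.Ioc 0 1).indicator (fun s => s ^ (-β))
  have hg : Integrable g := by
    rw [integrable_indicator_iff measurableSet_Ioc]
    exact (intervalIntegrable_iff_integrableOn_Ioc_of_le zero_le_one).1
      (intervalIntegral.intervalIntegrable_rpow' (by linarith))
  have hg0 (s : ℝ) : 0 ≤ g s := Set.indicator_nonneg (fun s hs => Real.rpow_nonneg hs.1.le _) s
  have hg2 : Integrable (fun s => g s + g (-s)) := hg.add hg.comp_neg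
  have hint (a : ℝ) : Integrable (fun s => g s + g (-s) + cauchyWeight (a - s)) :=
    hg2.add (integrable_cauchyWeight.comp_sub_left a)
  have hbound (a s : ℝ) (hs : s ≠ 0) :
      |s| ^ (-β) * cauchyWeight (a - s) ≤ g s + g (-s) + cauchyWeight (a - s) := by
    have hw := cauchyWeight_pos (a - s)
    have hw1 := cauchyWeight_le_one (a - s)
    rcases le_or_gt |s| 1 with h1 | h1
    · have h2 : |s| ^ (-β) ≤ g s + g (-s) := by
        rcases lt_or_gt_of_ne hs with h | h
        · rw [abs_of_neg h] at h1 ⊢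
          have : g (-s) = (-s) ^ (-β) := Set.indicator_of_mem (Set.mem_Ioc.2 ⟨by linarith, h1⟩) _
          linarith [hg0 s]
        · rw [abs_of_pos h] at h1 ⊢
          have : g s = s ^ (-β) := Set.indicator_of_mem (Set.mem_Ioc.2 ⟨h, h1⟩) _
          linarith [hg0 (-s)]
      have h3 : 0 ≤ |s| ^ (-β) := Real.rpow_nonneg (abs_nonneg _) _
      nlinarith
    · have : |s| ^ (-β) ≤ 1 := Real.rpow_le_one_of_one_le_of_nonpos h1.le (by linarith)
      nlinarith [hg0 s, hg0 (-s)]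
  have hae (a : ℝ) : ∀ᵐ s : ℝ, ‖|s| ^ (-β) * cauchyWeight (a - s)‖ ≤
      g s + g (-s) + cauchyWeight (a - s) := by
    filter_upwards [compl_mem_ae_iff.2 (measure_singleton (0 : ℝ))] with s hs
    rw [Real.norm_of_nonneg (mul_nonneg (Real.rpow_nonneg (abs_nonneg _) _)
      (cauchyWeight_pos _).le)]
    exact hbound a s hs
  have hmeas (a : ℝ) : AEStronglyMeasurable (fun s => |s| ^ (-β) * cauchyWeight (a - s)) := by
    have := continuous_cauchyWeight.measurable
    exact Measurable.aestronglyMeasurable (by fun_prop)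
  have hone (a : ℝ) : Integrable (fun s => |s| ^ (-β) * cauchyWeight (a - s)) :=
    (hint a).mono' (hmeas a) (hae a)
  set K : ℝ := (∫ s, g s) + (∫ s, g s) + ∫ s, cauchyWeight s
  have hK (a : ℝ) : ∫ s, |s| ^ (-β) * cauchyWeight (a - s) ≤ K := by
    calc _ ≤ ∫ s, (g s + g (-s) + cauchyWeight (a - s)) := by
          refine integral_mono_ae (hone a) (hint a) ?_
          filter_upwards [hae a] with s hs using (le_abs_self _).trans hs
      _ = K := by
          rw [integral_add hg2 (integrable_cauchyWeight.comp_sub_left a),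
            integral_add hg hg.comp_neg, integral_neg_eq_self g volume,
            integral_sub_left_eq_self cauchyWeight volume a]
  refine ⟨K, ?_, fun a h hh => ?_⟩
  · have h1 : 0 ≤ ∫ s, g s := integral_nonneg hg0
    have h2 : 0 ≤ ∫ s, cauchyWeight s := integral_nonneg fun s => (cauchyWeight_pos s).le
    positivity
  have heq : (fun s => |s| ^ (-β) * cauchyWeight ((a - s) / h)) = fun s =>
      h ^ (-β) * (fun t => |t| ^ (-β) * cauchyWeight (a / h - t)) (s / h) := by
    ext s
    simp only
    rw [← mul_assoc, ← Real.mul_rpow hh.le (abs_nonneg _), abs_div, abs_of_pos hh,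
      mul_div_cancel₀ _ hh.ne', sub_div]
  rw [heq]
  refine ⟨((hone (a / h)).comp_div hh.ne').const_mul _, ?_⟩
  rw [integral_const_mul, Measure.integral_comp_div
    (fun t => |t| ^ (-β) * cauchyWeight (a / h - t)), smul_eq_mul, abs_of_pos hh, ← mul_assoc,
    show h ^ (-β) * h = h ^ (1 - β) by
      rw [← Real.rpow_add_one hh.ne']; congr 1; ring, mul_comm]
  gcongr
  exact hK _

lemma exists_anisotropic_integral_bound {β : ℝ} (hβ : 0 ≤ β) (hβ1 : β < 1) :
    ∃ K : ℝ, 0 ≤ K ∧ ∀ (l A : ℝ) (x : ℝ × ℝ) (H : ℝ × ℝ → ℝ), 0 < l → 0 ≤ A →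
      AEStronglyMeasurable H →
      (∀ y : ℝ × ℝ, y.2 ≠ 0 → |H y| ≤ A * (cauchyWeight ((x.1 - y.1) / l) *
        (|y.2| ^ (-β) * cauchyWeight ((x.2 - y.2) / l ^ 2)))) →
      Integrable H ∧ |∫ y, H y| ≤ A * (K * l ^ (3 - 2 * β)) := by
  obtain ⟨K₀, hK₀, h₀⟩ := exists_integral_abs_rpow_mul_cauchyWeight_le le_rfl zero_lt_one
  obtain ⟨K₁, hK₁, h₁⟩ := exists_integral_abs_rpow_mul_cauchyWeight_le hβ hβ1
  refine ⟨K₀ * K₁, by positivity, fun l A x H hl hA hH hb => ?_⟩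
  obtain ⟨i₀, b₀⟩ := h₀ x.1 l hl
  obtain ⟨i₁, b₁⟩ := h₁ x.2 (l ^ 2) (by positivity)
  simp only [neg_zero, Real.rpow_zero, one_mul, sub_zero, Real.rpow_one] at i₀ b₀
  have hprod := (i₀.mul_prod i₁).const_mul A
  have hae : ∀ᵐ y : ℝ × ℝ, ‖H y‖ ≤ A * (cauchyWeight ((x.1 - y.1) / l) *
      (|y.2| ^ (-β) * cauchyWeight ((x.2 - y.2) / l ^ 2))) := by
    filter_upwards [ae_snd_ne_zero] with y hy using hb y hy
  refine ⟨hprod.mono' hH hae, ?_⟩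
  calc |∫ y, H y| ≤ ∫ y : ℝ × ℝ, A * (cauchyWeight ((x.1 - y.1) / l) *
      (|y.2| ^ (-β) * cauchyWeight ((x.2 - y.2) / l ^ 2))) :=
        norm_integral_le_of_norm_le hprod hae
    _ = A * ((∫ s, cauchyWeight ((x.1 - s) / l)) *
        ∫ s, |s| ^ (-β) * cauchyWeight ((x.2 - s) / l ^ 2)) := by
        rw [integral_const_mul]
        congr 1
        exact integral_prod_mul (fun s => cauchyWeight ((x.1 - s) / l))
          (fun s => |s| ^ (-β) * cauchyWeight ((x.2 - s) / l ^ 2))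
    _ ≤ A * ((K₀ * l) * (K₁ * (l ^ 2) ^ (1 - β))) := by
        gcongr
        exact integral_nonneg fun s => mul_nonneg (Real.rpow_nonneg (abs_nonneg _) _)
          (cauchyWeight_pos _).le
    _ = A * (K₀ * K₁ * l ^ (3 - 2 * β)) := by
        rw [← Real.rpow_natCast_mul hl.le,
          show (3 : ℝ) - 2 * β = 1 + (2 : ℕ) * (1 - β) by push_cast; ring, Real.rpow_add hl,
          Real.rpow_one]
        ring

/-! ### Bounds in terms of the parabolic distance -/

lemma pdist_nonneg (x y : ℝ × ℝ) : 0 ≤ pdist x y := by unfold pdist; positivity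

lemma pdist_rpow_le {l a : ℝ} (hl : 0 < l) (ha : 0 ≤ a) (ha2 : a ≤ 2) (x y : ℝ × ℝ) :
    pdist x y ^ a * (cauchyWeight ((x.1 - y.1) / l) * cauchyWeight ((x.2 - y.2) / l ^ 2))
      ≤ 2 * l ^ a := by
  set s := (x.1 - y.1) / l
  set t := (x.2 - y.2) / l ^ 2
  have hd : pdist x y = l * (|s| + Real.sqrt |t|) := by
    have h1 : x.1 - y.1 = l * s := by simp only [s]; field_simp
    have h2 : x.2 - y.2 = l ^ 2 * t := by simp only [t]; field_simp
    rw [pdist, h1, h2, abs_mul, abs_mul, abs_of_pos hl, abs_of_pos (by positivity : 0 < l ^ 2),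
      Real.sqrt_mul (by positivity), Real.sqrt_sq hl.le]
    ring
  set d := |s| + Real.sqrt |t|
  have hd0 : 0 ≤ d := by positivity
  have hsq : d ^ 2 ≤ 2 * ((1 + s ^ 2) * (1 + t ^ 2)) := by
    have h1 : Real.sqrt |t| ^ 2 = |t| := Real.sq_sqrt (abs_nonneg t)
    have h2 := sq_abs s
    have h3 := sq_abs t
    have h4 : d ^ 2 ≤ 2 * (|s| ^ 2 + Real.sqrt |t| ^ 2) := by
      simp only [d]
      nlinarith [sq_nonneg (|s| - Real.sqrt |t|)]
    nlinarith [sq_nonneg (|t| - 1), mul_nonneg (sq_nonneg s) (sq_nonneg t), sq_nonneg t]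
  have hpow : d ^ a ≤ 2 * ((1 + s ^ 2) * (1 + t ^ 2)) := by
    rcases le_or_gt d 1 with h | h
    · have := Real.rpow_le_one hd0 h ha
      nlinarith [mul_nonneg (sq_nonneg s) (sq_nonneg t), sq_nonneg t, sq_nonneg s]
    · have := Real.rpow_le_rpow_of_exponent_le h.le ha2
      rw [Real.rpow_two] at this
      linarith
  rw [hd, Real.mul_rpow hl.le hd0, cauchyWeight, cauchyWeight, ← mul_inv, ← div_eq_mul_inv,
    div_le_iff₀ (by positivity)]
  have : 0 ≤ l ^ a := Real.rpow_nonneg hl.le a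
  nlinarith

lemma exists_parabolic_integral_bound {β : ℝ} (hβ : 0 ≤ β) (hβ1 : β < 1) :
    ∃ K : ℝ, 0 ≤ K ∧ ∀ (l a B N : ℝ) (x : ℝ × ℝ) (H η : ℝ × ℝ → ℝ), 0 < l → 0 ≤ a → a ≤ 2 →
      0 ≤ B → 0 ≤ N →
      (∀ z : ℝ × ℝ, |η z| ≤ N * (cauchyWeight (z.1 / l) * cauchyWeight (z.2 / l ^ 2)) ^ 2) →
      AEStronglyMeasurable H →
      (∀ y : ℝ × ℝ, y.2 ≠ 0 → |H y| ≤ B * (pdist x y ^ a * |y.2| ^ (-β)) * |η (x - y)|) →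
      Integrable H ∧ |∫ y, H y| ≤ 2 * B * N * K * l ^ (3 + a - 2 * β) := by
  obtain ⟨K, hK, h⟩ := exists_anisotropic_integral_bound hβ hβ1
  refine ⟨K, hK, fun l a B N x H η hl ha ha2 hB hN hη hH hb => ?_⟩
  have key := h l (2 * B * N * l ^ a) x H hl (by positivity) hH fun y hy => by
    set w := cauchyWeight ((x.1 - y.1) / l) * cauchyWeight ((x.2 - y.2) / l ^ 2)
    have hw : 0 ≤ w := mul_nonneg (cauchyWeight_pos _).le (cauchyWeight_pos _).le
    have hd := pdist_rpow_le hl ha ha2 x y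
    have h0 : 0 ≤ pdist x y ^ a := Real.rpow_nonneg (pdist_nonneg x y) a
    have h1 : 0 ≤ |y.2| ^ (-β) := by positivity
    calc |H y| ≤ B * (pdist x y ^ a * |y.2| ^ (-β)) * |η (x - y)| := hb y hy
      _ ≤ B * (pdist x y ^ a * |y.2| ^ (-β)) * (N * w ^ 2) := by
          gcongr
          exact hη (x - y)
      _ = (B * N * |y.2| ^ (-β) * w) * (pdist x y ^ a * w) := by ring
      _ ≤ (B * N * |y.2| ^ (-β) * w) * (2 * l ^ a) := by gcongr
      _ = _ := by simp only [w]; ring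
  refine ⟨key.1, key.2.trans_eq ?_⟩
  rw [show 3 + a - 2 * β = a + (3 - 2 * β) by ring, Real.rpow_add hl]
  ring

lemma SchwartzMap.integrable_mul_mul_comp_sub {a β B A : ℝ} (ha : 0 ≤ a) (ha2 : a ≤ 2)
    (hβ : 0 ≤ β) (hβ1 : β < 1) (φ : SchwartzMap (ℝ × ℝ) ℝ) {f g : ℝ × ℝ → ℝ} {x : ℝ × ℝ}
    (hf : Continuous f) (hfB : ∀ y, |f y| ≤ B) (hg : AEStronglyMeasurable g) (hA : 0 ≤ A)
    (hgA : ∀ y : ℝ × ℝ, y.2 ≠ 0 → |g y| ≤ A * (pdist x y ^ a * |y.2| ^ (-β))) :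
    Integrable (fun y => f y * g y * φ (x - y)) := by
  obtain ⟨M, hM, hφ⟩ := φ.exists_cauchyWeight_bound
  obtain ⟨K, -, h⟩ := exists_parabolic_integral_bound hβ hβ1
  have hB : 0 ≤ B := (abs_nonneg _).trans (hfB 0)
  refine (h 1 a (B * A) M x (fun y => f y * g y * φ (x - y)) φ one_pos ha ha2
    (by positivity) hM (by simpa using hφ)
    ((hf.aestronglyMeasurable.mul hg).mul
      (φ.continuous.comp (continuous_const.sub continuous_id)).aestronglyMeasurable)
    fun y hy => ?_).1
  rw [abs_mul, abs_mul, mul_assoc B]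
  gcongr
  · exact hfB y
  · exact hgA y hy

/-! ### Regularity of Hölder functions and their derivatives -/

lemma continuous_of_pdist_holder {α A : ℝ} (hα : 0 < α) {F : ℝ × ℝ → ℝ}
    (hF : ∀ x y : ℝ × ℝ, |F x - F y| ≤ A * pdist x y ^ α) : Continuous F := by
  rw [continuous_iff_continuousAt]
  intro x
  have hc : Continuous (fun y => A * pdist y x ^ α) := by
    refine continuous_const.mul (Continuous.rpow_const ?_ fun _ => Or.inr hα.le)
    unfold pdist
    fun_prop
  have h0 : Filter.Tendsto (fun y => A * pdist y x ^ α) (nhds x) (nhds 0) := by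
    have := hc.tendsto x
    simpa [pdist, Real.zero_rpow hα.ne'] using this
  rw [ContinuousAt, tendsto_iff_norm_sub_tendsto_zero]
  exact squeeze_zero (fun _ => norm_nonneg _) (fun y => hF y x) h0

lemma holder_const_nonneg {α A : ℝ} {F : ℝ × ℝ → ℝ}
    (hF : ∀ x y : ℝ × ℝ, |F x - F y| ≤ A * pdist x y ^ α) : 0 ≤ A := by
  simpa [pdist] using (abs_nonneg _).trans (hF (0, 0) (1, 0))

lemma measurable_pd1 {G : ℝ × ℝ → ℝ} (hG : Continuous G) : Measurable (pd1 G) :=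
  (measurable_deriv_with_param (f := fun b s => G (s, b))
    (hG.comp (continuous_snd.prodMk continuous_fst))).comp measurable_swap

lemma aemeasurable_pd1 {g : ℝ × ℝ → ℝ} (hg : Measurable g)
    (hd : ∀ x : ℝ × ℝ, x.2 ≠ 0 → DifferentiableAt ℝ (fun s => g (s, x.2)) x.1) :
    AEMeasurable (pd1 g) := by
  refine aemeasurable_of_tendsto_metrizable_ae' (f := fun (n : ℕ) (x : ℝ × ℝ) =>
    ((1 : ℝ) / (n + 1))⁻¹ • (g (x.1 + 1 / (n + 1), x.2) - g (x.1, x.2))) (fun n => ?_) ?_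
  · exact Measurable.aemeasurable (by fun_prop)
  · filter_upwards [ae_snd_ne_zero] with x hx
    refine (hd x hx).hasDerivAt.tendsto_slope_zero.comp (tendsto_nhdsWithin_iff.2
      ⟨tendsto_one_div_add_atTop_nhds_zero_nat, .of_forall fun n => ?_⟩)
    simp only [Set.mem_compl_iff, Set.mem_singleton_iff]
    positivity

/-! ### The commutator -/

/-- `G` is parabolically `α`-Hölder with constant `A`, and off `{x₂ = 0}` it is twice
differentiable in `x₁` with `|∂₁^k G| ≤ D |x₂|^{(α-k)/2}` for `k = 1, 2`. -/
structure IsSingularHolder (α A D : ℝ) (G : ℝ × ℝ → ℝ) : Prop where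
  holder : ∀ x y : ℝ × ℝ, |G x - G y| ≤ A * pdist x y ^ α
  diff : ∀ x : ℝ × ℝ, x.2 ≠ 0 → DifferentiableAt ℝ (fun s : ℝ => G (s, x.2)) x.1
  diff_pd1 : ∀ x : ℝ × ℝ, x.2 ≠ 0 → DifferentiableAt ℝ (fun s : ℝ => pd1 G (s, x.2)) x.1
  pd1_le : ∀ x : ℝ × ℝ, x.2 ≠ 0 → |pd1 G x| ≤ D * |x.2| ^ ((α - 1) / 2)
  pd1_pd1_le : ∀ x : ℝ × ℝ, x.2 ≠ 0 → |pd1 (pd1 G) x| ≤ D * |x.2| ^ ((α - 2) / 2)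

namespace IsSingularHolder

variable {α A D : ℝ} {G : ℝ × ℝ → ℝ}

lemma nonneg (hG : IsSingularHolder α A D G) : 0 ≤ D := by
  simpa using (abs_nonneg _).trans (hG.pd1_le (0, 1) one_ne_zero)

lemma continuous (hG : IsSingularHolder α A D G) (hα : 0 < α) : Continuous G :=
  continuous_of_pdist_holder hα hG.holder

lemma aestronglyMeasurable_pd1 (hG : IsSingularHolder α A D G) (hα : 0 < α) :
    AEStronglyMeasurable (pd1 G) :=
  (measurable_pd1 (hG.continuous hα)).aestronglyMeasurable

lemma aestronglyMeasurable_pd1_pd1 (hG : IsSingularHolder α A D G) (hα : 0 < α) :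
    AEStronglyMeasurable (pd1 (pd1 G)) :=
  (aemeasurable_pd1 (measurable_pd1 (hG.continuous hα)) hG.diff_pd1).aestronglyMeasurable

lemma sub_bound (hG : IsSingularHolder α A D G) (x y : ℝ × ℝ) :
    |G x - G y| ≤ A * (pdist x y ^ α * |y.2| ^ (-(0 : ℝ))) := by
  simpa using hG.holder x y

lemma pd1_bound (hG : IsSingularHolder α A D G) (x y : ℝ × ℝ) (hy : y.2 ≠ 0) :
    |pd1 G y| ≤ D * (pdist x y ^ (0 : ℝ) * |y.2| ^ (-((1 - α) / 2))) := by
  rw [Real.rpow_zero, one_mul, show -((1 - α) / 2) = (α - 1) / 2 by ring]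
  exact hG.pd1_le y hy

lemma pd1_pd1_bound (hG : IsSingularHolder α A D G) (x y : ℝ × ℝ) (hy : y.2 ≠ 0) :
    |pd1 (pd1 G) y| ≤ D * (pdist x y ^ (0 : ℝ) * |y.2| ^ (-((2 - α) / 2))) := by
  rw [Real.rpow_zero, one_mul, show -((2 - α) / 2) = (α - 2) / 2 by ring]
  exact hG.pd1_pd1_le y hy

lemma integrable_sub_mul (hG : IsSingularHolder α A D G) (hα : 0 < α) (hα1 : α < 1)
    (φ : SchwartzMap (ℝ × ℝ) ℝ) {f : ℝ × ℝ → ℝ} {B : ℝ} (hf : Continuous f)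
    (hfB : ∀ y, |f y| ≤ B) (x : ℝ × ℝ) :
    Integrable (fun y => f y * (G x - G y) * φ (x - y)) :=
  φ.integrable_mul_mul_comp_sub hα.le (by linarith) le_rfl zero_lt_one hf hfB
    (continuous_const.sub (hG.continuous hα)).aestronglyMeasurable
    (holder_const_nonneg hG.holder) fun y _ => hG.sub_bound x y

lemma integrable_pd1_mul (hG : IsSingularHolder α A D G) (hα : 0 < α) (hα1 : α < 1)
    (φ : SchwartzMap (ℝ × ℝ) ℝ) {f : ℝ × ℝ → ℝ} {B : ℝ} (hf : Continuous f)
    (hfB : ∀ y, |f y| ≤ B) (x : ℝ × ℝ) :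
    Integrable (fun y => f y * pd1 G y * φ (x - y)) :=
  φ.integrable_mul_mul_comp_sub le_rfl (by norm_num) (by linarith) (by linarith) hf hfB
    (hG.aestronglyMeasurable_pd1 hα) hG.nonneg fun y hy => hG.pd1_bound x y hy

lemma integrable_pd1_pd1_mul (hG : IsSingularHolder α A D G) (hα : 0 < α) (hα1 : α < 1)
    (φ : SchwartzMap (ℝ × ℝ) ℝ) {f : ℝ × ℝ → ℝ} {B : ℝ} (hf : Continuous f)
    (hfB : ∀ y, |f y| ≤ B) (x : ℝ × ℝ) :
    Integrable (fun y => f y * pd1 (pd1 G) y * φ (x - y)) :=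
  φ.integrable_mul_mul_comp_sub le_rfl (by norm_num) (by linarith) (by linarith) hf hfB
    (hG.aestronglyMeasurable_pd1_pd1 hα) hG.nonneg fun y hy => hG.pd1_pd1_bound x y hy

/-- The commutator kernel is `∂₁²[(G(x) - G) φ(x - ·)]`, hence has zero mean. -/
lemma integral_commutator_kernel_eq_zero (hG : IsSingularHolder α A D G) (hα : 0 < α)
    (hα1 : α < 1) {φ φ₁ φ₂ : SchwartzMap (ℝ × ℝ) ℝ} (h₁ : pd1 φ = φ₁) (h₂ : pd1 φ₁ = φ₂)
    (x : ℝ × ℝ) :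
    (∫ y, (G x - G y) * φ₂ (x - y)) + 2 * (∫ y, pd1 G y * φ₁ (x - y))
      - (∫ y, pd1 (pd1 G) y * φ (x - y)) = 0 := by
  have hone : ∀ y : ℝ × ℝ, |(fun _ => (1 : ℝ)) y| ≤ 1 := by simp
  have i2 := hG.integrable_sub_mul hα hα1 φ₂ continuous_const hone x
  have i1 := hG.integrable_pd1_mul hα hα1 φ₁ continuous_const hone x
  have i0 := hG.integrable_pd1_pd1_mul hα hα1 φ continuous_const hone x
  have j1 := hG.integrable_sub_mul hα hα1 φ₁ continuous_const hone x
  have j0 := hG.integrable_pd1_mul hα hα1 φ continuous_const hone x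
  simp only [one_mul] at i0 i1 i2 j0 j1
  set P : ℝ × ℝ → ℝ := fun y => -(pd1 G y * φ (x - y)) - (G x - G y) * φ₁ (x - y)
  set K : ℝ × ℝ → ℝ := fun y =>
    (G x - G y) * φ₂ (x - y) + 2 * (pd1 G y * φ₁ (x - y)) - pd1 (pd1 G) y * φ (x - y)
  have hP : Integrable P := j0.neg.sub j1
  have i12 : Integrable (fun y => (G x - G y) * φ₂ (x - y) + 2 * (pd1 G y * φ₁ (x - y))) :=
    i2.add (i1.const_mul 2)
  have hK : Integrable K := i12.sub i0
  have hφ (η : SchwartzMap (ℝ × ℝ) ℝ) (y : ℝ × ℝ) :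
      HasDerivAt (fun s => η (x - (s, y.2))) (-pd1 η (x - y)) y.1 :=
    (η.hasDerivAt_pd1 (x - y)).comp_const_sub x.1 y.1
  have hderiv (y : ℝ × ℝ) (hy : y.2 ≠ 0) : HasDerivAt (fun s => P (s, y.2)) (K y) y.1 := by
    have d1 := (hG.diff_pd1 y hy).hasDerivAt
    have d0 := (hG.diff y hy).hasDerivAt
    have := ((d1.mul (hφ φ y)).neg).sub ((d0.const_sub (G x)).mul (hφ φ₁ y))
    refine this.congr_deriv ?_
    rw [h₁, h₂]
    simp only [K, pd1, Prod.mk.eta]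
    ring
  have hK0 : ∫ y, K y = 0 := by
    have hae : ∀ᵐ t : ℝ, ∫ s, K (s, t) = 0 := by
      filter_upwards [compl_mem_ae_iff.2 (measure_singleton (0 : ℝ)),
        Integrable.prod_left_ae (μ := volume) (ν := volume) hP,
        Integrable.prod_left_ae (μ := volume) (ν := volume) hK] with t ht hPt hKt
      exact integral_eq_zero_of_hasDerivAt_of_integrable (fun s => hderiv (s, t) ht) hKt hPt
    rw [Measure.volume_eq_prod, integral_prod_symm K hK, integral_congr_ae hae, integral_zero]
  rw [← hK0, integral_sub i12 i0, integral_add i2 (i1.const_mul 2), integral_const_mul]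

lemma commT_eq (hG : IsSingularHolder α A D G) (hα : 0 < α) (hα1 : α < 1)
    {ψ : ℝ → ℝ × ℝ → ℝ} {T : ℝ} {φ φ₁ φ₂ : SchwartzMap (ℝ × ℝ) ℝ} (h₀ : ψ T = φ)
    (h₁ : pd1 φ = φ₁) (h₂ : pd1 φ₁ = φ₂) {F : ℝ × ℝ → ℝ} {B : ℝ} (hF : Continuous F)
    (hFB : ∀ y, |F y| ≤ B) (x : ℝ × ℝ) :
    commT ψ T F G x = (∫ y, (F y - F x) * (G x - G y) * φ₂ (x - y))
      + 2 * (∫ y, (F y - F x) * pd1 G y * φ₁ (x - y))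
      - ∫ y, (F y - F x) * pd1 (pd1 G) y * φ (x - y) := by
  have hone : ∀ y : ℝ × ℝ, |(fun _ => (1 : ℝ)) y| ≤ 1 := by simp
  have i2 := hG.integrable_sub_mul hα hα1 φ₂ continuous_const hone x
  have i1 := hG.integrable_pd1_mul hα hα1 φ₁ continuous_const hone x
  have i0 := hG.integrable_pd1_pd1_mul hα hα1 φ continuous_const hone x
  simp only [one_mul] at i0 i1 i2
  have f2 := hG.integrable_sub_mul hα hα1 φ₂ hF hFB x
  have f1 := hG.integrable_pd1_mul hα hα1 φ₁ hF hFB x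
  have f0 := hG.integrable_pd1_pd1_mul hα hα1 φ hF hFB x
  have f : Integrable (fun y => F y * φ₂ (x - y)) :=
    (φ₂.integrable.comp_sub_left x).bdd_mul hF.aestronglyMeasurable (.of_forall hFB)
  have e2 : G x * (∫ y, F y * φ₂ (x - y)) - ∫ y, F y * G y * φ₂ (x - y)
      = ∫ y, F y * (G x - G y) * φ₂ (x - y) := by
    have fG : Integrable (fun y => F y * G y * φ₂ (x - y)) := by
      refine ((f.const_mul (G x)).sub f2).congr (.of_forall fun y => ?_)
      simp only [Pi.sub_apply]
      ring
    rw [← integral_const_mul, ← integral_sub (f.const_mul _) fG]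
    congr with y
    ring
  have hsplit {g : ℝ × ℝ → ℝ} {η : SchwartzMap (ℝ × ℝ) ℝ}
      (hg : Integrable (fun y => F y * g y * η (x - y)))
      (hη : Integrable (fun y => g y * η (x - y))) :
      ∫ y, (F y - F x) * g y * η (x - y)
        = (∫ y, F y * g y * η (x - y)) - F x * ∫ y, g y * η (x - y) := by
    rw [← integral_const_mul, ← integral_sub hg (hη.const_mul _)]
    congr with y
    ring
  rw [commT, h₀, h₁, h₂, e2, hsplit (g := fun y => G x - G y) f2 i2, hsplit f1 i1, hsplit f0 i0]
  linear_combination F x * hG.integral_commutator_kernel_eq_zero hα hα1 h₁ h₂ x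

end IsSingularHolder

lemma parabolic_product_bound {α a b A D : ℝ} {F g : ℝ × ℝ → ℝ} {x y : ℝ × ℝ} (hA : 0 ≤ A)
    (ha : 0 ≤ a) (hα : 0 < α)
    (hF : ∀ x y : ℝ × ℝ, |F x - F y| ≤ A * pdist x y ^ α)
    (hg : |g y| ≤ D * (pdist x y ^ a * |y.2| ^ b)) (η : ℝ × ℝ → ℝ) :
    |(F y - F x) * g y * η (x - y)|
      ≤ A * D * (pdist x y ^ (α + a) * |y.2| ^ b) * |η (x - y)| := by
  have h0 := pdist_nonneg x y
  rw [abs_mul, abs_mul, abs_sub_comm, Real.rpow_add_of_nonneg h0 hα.le ha]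
  refine mul_le_mul_of_nonneg_right ?_ (abs_nonneg _)
  calc |F x - F y| * |g y| ≤ (A * pdist x y ^ α) * (D * (pdist x y ^ a * |y.2| ^ b)) := by
        gcongr
        exact hF x y
    _ = _ := by ring

lemma abs_scaled_le {f : ℝ × ℝ → ℝ} {M c l : ℝ} (hc : 0 ≤ c)
    (hf : ∀ z : ℝ × ℝ, |f z| ≤ M * (cauchyWeight z.1 * cauchyWeight z.2) ^ 2) (z : ℝ × ℝ) :
    |c * f (z.1 / l, z.2 / l ^ 2)|
      ≤ c * M * (cauchyWeight (z.1 / l) * cauchyWeight (z.2 / l ^ 2)) ^ 2 := by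
  rw [abs_mul, abs_of_nonneg hc, mul_assoc]
  gcongr
  exact hf _

/-- commutator estimate for the generalized product
`G ◊ ∂₁²F` (second type of new offline product). -/
theorem generalized_product_commutator_estimate
    (ψ : ℝ → ℝ × ℝ → ℝ) (hψ : IsPsiKernel ψ)
    (α : ℝ) (hα : 0 < α) (hα1 : α < 1) :
    ∃ C : ℝ, ∀ (F G : ℝ × ℝ → ℝ) (BF AF AG CG : ℝ),
      (∀ x : ℝ × ℝ, |F x| ≤ BF) →
      (∀ x y : ℝ × ℝ, |F x - F y| ≤ AF * pdist x y ^ α) →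
      (∀ x y : ℝ × ℝ, |G x - G y| ≤ AG * pdist x y ^ α) →
      (∀ x : ℝ × ℝ, x.2 ≠ 0 → DifferentiableAt ℝ (fun s : ℝ => G (s, x.2)) x.1) →
      (∀ x : ℝ × ℝ, x.2 ≠ 0 → DifferentiableAt ℝ (fun s : ℝ => pd1 G (s, x.2)) x.1) →
      (∀ x : ℝ × ℝ, x.2 ≠ 0 → |pd1 G x| ≤ CG * |x.2| ^ ((α - 1) / 2)) →
      (∀ x : ℝ × ℝ, x.2 ≠ 0 → |pd1 (pd1 G) x| ≤ CG * |x.2| ^ ((α - 2) / 2)) →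
      ∀ T : ℝ, 0 < T → T ≤ 1 → ∀ x : ℝ × ℝ,
        |commT ψ T F G x| ≤ C * (CG + AG) * AF * T ^ ((2 * α - 2) / 4) := by
  obtain ⟨φ, hφ⟩ := hψ.1 1 one_pos
  obtain ⟨φ₁, hφ₁⟩ := φ.exists_eq_pd1
  obtain ⟨φ₂, hφ₂⟩ := φ₁.exists_eq_pd1
  obtain ⟨M₀, hM₀, hb₀⟩ := φ.exists_cauchyWeight_bound
  obtain ⟨M₁, hM₁, hb₁⟩ := φ₁.exists_cauchyWeight_bound
  obtain ⟨M₂, hM₂, hb₂⟩ := φ₂.exists_cauchyWeight_bound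
  obtain ⟨K₂, hK₂, hint₂⟩ := exists_parabolic_integral_bound le_rfl zero_lt_one
  obtain ⟨K₁, hK₁, hint₁⟩ :=
    exists_parabolic_integral_bound (β := (1 - α) / 2) (by linarith) (by linarith)
  obtain ⟨K₀, hK₀, hint₀⟩ :=
    exists_parabolic_integral_bound (β := (2 - α) / 2) (by linarith) (by linarith)
  refine ⟨2 * M₂ * K₂ + 4 * M₁ * K₁ + 2 * M₀ * K₀, ?_⟩
  intro F G BF AF AG CG hFB hF hGh hd hd1 hG1 hG2 T hT _ x
  have hG : IsSingularHolder α AG CG G := ⟨hGh, hd, hd1, hG1, hG2⟩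
  have hAF := holder_const_nonneg hF
  have hAG := holder_const_nonneg hGh
  have hCG := hG.nonneg
  have hFc := continuous_of_pdist_holder hα hF
  obtain ⟨l, hl, rfl⟩ : ∃ l : ℝ, 0 < l ∧ T = l ^ 4 :=
    ⟨T ^ (1 / 4 : ℝ), by positivity, by
      rw [← Real.rpow_natCast, ← Real.rpow_mul hT.le]; norm_num⟩
  obtain ⟨η, hη⟩ := hψ.1 (l ^ 4) hT
  obtain ⟨η₁, hη₁⟩ := η.exists_eq_pd1
  obtain ⟨η₂, hη₂⟩ := η₁.exists_eq_pd1
  have s₀ : (η : ℝ × ℝ → ℝ) = fun z => (l ^ 3)⁻¹ * φ (z.1 / l, z.2 / l ^ 2) := by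
    rw [← hη, ← hφ]
    exact funext (hψ.scaling hl)
  have s₁ : (η₁ : ℝ × ℝ → ℝ) = fun z => (l ^ 3)⁻¹ / l * φ₁ (z.1 / l, z.2 / l ^ 2) := by
    rw [← hη₁, s₀, pd1_scale, hφ₁]
  have s₂ : (η₂ : ℝ × ℝ → ℝ) = fun z => (l ^ 3)⁻¹ / l / l * φ₂ (z.1 / l, z.2 / l ^ 2) := by
    rw [← hη₂, s₁, pd1_scale, hφ₂]
  have hmeas (κ : SchwartzMap (ℝ × ℝ) ℝ) {g : ℝ × ℝ → ℝ} (hg : AEStronglyMeasurable g) :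
      AEStronglyMeasurable (fun y => (F y - F x) * g y * κ (x - y)) :=
    ((hFc.sub continuous_const).aestronglyMeasurable.mul hg).mul
      (κ.continuous.comp (continuous_const.sub continuous_id)).aestronglyMeasurable
  have t₂ := (hint₂ l (α + α) (AF * AG) ((l ^ 3)⁻¹ / l / l * M₂) x _ η₂ hl (by linarith)
    (by linarith) (by positivity) (by positivity)
    (by rw [s₂]; exact abs_scaled_le (by positivity) hb₂)
    (hmeas η₂ (g := fun y => G x - G y)
      (continuous_const.sub (hG.continuous hα)).aestronglyMeasurable)
    fun y _ => parabolic_product_bound (g := fun y => G x - G y) hAF hα.le hα hF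
      (hG.sub_bound x y) η₂).2
  have t₁ := (hint₁ l (α + 0) (AF * CG) ((l ^ 3)⁻¹ / l * M₁) x _ η₁ hl (by linarith)
    (by linarith) (by positivity) (by positivity)
    (by rw [s₁]; exact abs_scaled_le (by positivity) hb₁)
    (hmeas η₁ (hG.aestronglyMeasurable_pd1 hα))
    fun y hy => parabolic_product_bound hAF le_rfl hα hF (hG.pd1_bound x y hy) η₁).2
  have t₀ := (hint₀ l (α + 0) (AF * CG) ((l ^ 3)⁻¹ * M₀) x _ η hl (by linarith)
    (by linarith) (by positivity) (by positivity)
    (by rw [s₀]; exact abs_scaled_le (by positivity) hb₀)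
    (hmeas η (hG.aestronglyMeasurable_pd1_pd1 hα))
    fun y hy => parabolic_product_bound hAF le_rfl hα hF (hG.pd1_pd1_bound x y hy) η).2
  have hpow : (l ^ 4) ^ ((2 * α - 2) / 4) = l ^ (2 * α - 2) := by
    rw [← Real.rpow_natCast_mul hl.le]
    congr 1
    push_cast
    ring
  set L := l ^ (2 * α - 2)
  have hL : 0 ≤ L := by positivity
  have hlpow (n : ℕ) : l ^ (2 * α - 2 + n) = L * l ^ n := by
    rw [Real.rpow_add hl, Real.rpow_natCast]
  rw [show 3 + (α + α) - 2 * 0 = 2 * α - 2 + (5 : ℕ) by push_cast; ring, hlpow,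
    show 2 * (AF * AG) * ((l ^ 3)⁻¹ / l / l * M₂) * K₂ * (L * l ^ 5)
      = 2 * M₂ * K₂ * (AF * AG * L) by field_simp] at t₂
  rw [show 3 + (α + 0) - 2 * ((1 - α) / 2) = 2 * α - 2 + (4 : ℕ) by push_cast; ring, hlpow,
    show 2 * (AF * CG) * ((l ^ 3)⁻¹ / l * M₁) * K₁ * (L * l ^ 4)
      = 2 * M₁ * K₁ * (AF * CG * L) by field_simp] at t₁
  rw [show 3 + (α + 0) - 2 * ((2 - α) / 2) = 2 * α - 2 + (3 : ℕ) by push_cast; ring, hlpow,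
    show 2 * (AF * CG) * ((l ^ 3)⁻¹ * M₀) * K₀ * (L * l ^ 3)
      = 2 * M₀ * K₀ * (AF * CG * L) by field_simp] at t₀
  rw [hG.commT_eq hα hα1 hη hη₁ hη₂ hFc hFB x, hpow]
  rw [abs_le] at t₀ t₁ t₂
  have p₂ : 0 ≤ 2 * M₂ * K₂ * (AF * CG * L) := by positivity
  have p₁ : 0 ≤ 4 * M₁ * K₁ * (AF * AG * L) := by positivity
  have p₀ : 0 ≤ 2 * M₀ * K₀ * (AF * AG * L) := by positivity
  rw [abs_le]
  constructor <;> linarith [t₀.1, t₀.2, t₁.1, t₁.2, t₂.1, t₂.2]
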